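/- For every integer k there exists a graph G such that χ_ℓ(G²) − χ(G²) ≥ k; that is, the gap between the list chromatic number and the chromatic number of squares of graphs can be arbitrarily large. -/

import Mathlib

/-- Vertex type of the Latin-square construction graph: `Sum.inl (a, c)` encodes the
vertex `v_{a+1, c+1}` of `P`, and `Sum.inr (i, j)` encodes the vertex `w_{i+1, j+1}` of `Q`
(all indices written 0-indexed via `Fin`/`ZMod`). -/
def LSVertex (n : ℕ) : Type := (Fin n × ZMod n) ⊕ (Fin (n - 1) × ZMod n)

/-- The Latin-square construction graph: the cliques `T_j` consist of the `P`-vertices with a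
fixed second coordinate, and `w_{i,j}` is joined to `v_{k, L_i(j,k)}` for every `k`, where
`L_i(j,k) ≡ j + i(k-1) (mod n)` (all written 0-indexed, so the second coordinate of a
neighbor `v_{k, L_i(j,k)}` of `w_{i,j}` is `(j-1) + i·(k-1)` in `ZMod n`). -/
def latinGraph (n : ℕ) : SimpleGraph (LSVertex n) where
  Adj x y :=
    match x, y with
    | Sum.inl (a, c), Sum.inl (b, c') => c = c' ∧ a ≠ b
    | Sum.inl (k, c), Sum.inr (i, j) => c = j + (((i : ℕ) : ZMod n) + 1) * ((k : ℕ) : ZMod n)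
    | Sum.inr (i, j), Sum.inl (k, c) => c = j + (((i : ℕ) : ZMod n) + 1) * ((k : ℕ) : ZMod n)
    | Sum.inr _, Sum.inr _ => False
  symm := by
    constructor
    rintro (⟨a, c⟩ | ⟨i, j⟩) (⟨b, c'⟩ | ⟨i', j'⟩) h
    · exact ⟨h.1.symm, h.2.symm⟩
    · exact h
    · exact h
    · exact h
  loopless := by
    constructor
    rintro (⟨a, c⟩ | ⟨i, j⟩) h
    · exact h.2 rfl
    · exact h

/-- The set `P` of all `v`-vertices. -/
def Pall (n : ℕ) : Set (LSVertex n) := {x | ∃ a c, x = Sum.inl (a, c)}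

/-- The set `Q` of all `w`-vertices. -/
def Qall (n : ℕ) : Set (LSVertex n) := {x | ∃ i j, x = Sum.inr (i, j)}

/-- The partite set `P_{a+1} = {v_{a+1,1}, …, v_{a+1,n}}`. -/
def Pset (n : ℕ) (a : Fin n) : Set (LSVertex n) := {x | ∃ c, x = Sum.inl (a, c)}

/-- The clique `T_{c+1} = {v_{1,c+1}, …, v_{n,c+1}}`. -/
def Tset (n : ℕ) (c : ZMod n) : Set (LSVertex n) := {x | ∃ a, x = Sum.inl (a, c)}

/-- The partite set `Q_{i+1} = {w_{i+1,1}, …, w_{i+1,n}}`. -/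
def Qset (n : ℕ) (i : Fin (n - 1)) : Set (LSVertex n) := {x | ∃ j, x = Sum.inr (i, j)}

/-- The square of a graph: two distinct vertices are adjacent iff their distance in `G`
is at most 2, i.e. they are adjacent in `G` or have a common neighbor. -/
def graphSquare {V : Type*} (G : SimpleGraph V) : SimpleGraph V where
  Adj x y := x ≠ y ∧ (G.Adj x y ∨ ∃ z, G.Adj x z ∧ G.Adj z y)
  symm := by
    constructor
    rintro x y ⟨hxy, h | ⟨z, h1, h2⟩⟩
    · exact ⟨hxy.symm, Or.inl h.symm⟩
    · exact ⟨hxy.symm, Or.inr ⟨z, h2.symm, h1.symm⟩⟩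
  loopless := ⟨fun x h => h.1 rfl⟩

/-- `G` is `k`-choosable: for any assignment of a list of at least `k` colors to each
vertex, there is a proper coloring choosing each vertex's color from its list. -/
def Choosable {V : Type*} (G : SimpleGraph V) (k : ℕ) : Prop :=
  ∀ L : V → Finset ℕ, (∀ v, k ≤ (L v).card) →
    ∃ φ : V → ℕ, (∀ v, φ v ∈ L v) ∧ ∀ ⦃u w⦄, G.Adj u w → φ u ≠ φ w

/-- The list chromatic number: the least `k` such that `G` is `k`-choosable. -/
noncomputable def listChromaticNumber {V : Type*} (G : SimpleGraph V) : ℕ :=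
  sInf {k | Choosable G k}

/-- The chromatic number: the least `k` such that `G` has a proper `k`-coloring. -/
noncomputable def chromNum {V : Type*} (G : SimpleGraph V) : ℕ :=
  sInf {k | G.Colorable k}

/-- The index of the partite set of a vertex. -/
def lsPart (n : ℕ) : LSVertex n → Fin n ⊕ Fin (n - 1)
  | Sum.inl (a, _) => Sum.inl a
  | Sum.inr (i, _) => Sum.inr i

/-- The position of a vertex within its partite set. -/
def lsPos (n : ℕ) : LSVertex n → ZMod n
  | Sum.inl (_, c) => c
  | Sum.inr (_, j) => j

/-- The vertex in a given partite set at a given position. -/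
def lsMk (n : ℕ) : Fin n ⊕ Fin (n - 1) → ZMod n → LSVertex n
  | Sum.inl a, c => Sum.inl (a, c)
  | Sum.inr i, c => Sum.inr (i, c)

lemma lsPart_mk (n : ℕ) (p : Fin n ⊕ Fin (n - 1)) (c : ZMod n) : lsPart n (lsMk n p c) = p := by
  cases p <;> rfl

lemma lsPos_mk (n : ℕ) (p : Fin n ⊕ Fin (n - 1)) (c : ZMod n) : lsPos n (lsMk n p c) = c := by
  cases p <;> rfl

lemma cast_inj_of_lt {n a b : ℕ} (ha : a < n) (hb : b < n)
    (h : (a : ZMod n) = (b : ZMod n)) : a = b := by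
  rw [ZMod.natCast_eq_natCast_iff] at h
  exact Nat.ModEq.eq_of_lt_of_lt h ha hb

lemma exists_fin {n : ℕ} [NeZero n] (x : ZMod n) : ∃ k : Fin n, ((k : ℕ) : ZMod n) = x :=
  ⟨⟨x.val, x.val_lt⟩, ZMod.natCast_zmod_val x⟩

lemma exists_fin_pred {n : ℕ} [NeZero n] (x : ZMod n) (hx : x ≠ 0) :
    ∃ i : Fin (n - 1), ((i : ℕ) : ZMod n) + 1 = x := by
  have h0 : x.val ≠ 0 := by simpa [ZMod.val_eq_zero] using hx
  have h1 := x.val_lt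
  refine ⟨⟨x.val - 1, by omega⟩, ?_⟩
  have : ((x.val - 1 + 1 : ℕ) : ZMod n) = x := by
    rw [Nat.sub_add_cancel (by omega)]; exact ZMod.natCast_zmod_val x
  push_cast at this
  exact this

lemma square_not_adj (n : ℕ) (x y : LSVertex n) (h : (graphSquare (latinGraph n)).Adj x y) :
    lsPart n x ≠ lsPart n y := by
  obtain ⟨hne, h⟩ := h
  intro hp
  rcases x with ⟨a, c⟩ | ⟨i, j⟩ <;> rcases y with ⟨b, d⟩ | ⟨i', j'⟩
  · have hab : a = b := Sum.inl_injective hp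
    subst hab
    rcases h with h | ⟨⟨k, e⟩ | ⟨k, e⟩, h1, h2⟩
    · exact h.2 rfl
    · exact hne (by rw [show c = d from h1.1.trans h2.1])
    · have h1 : c = _ := h1
      have h2 : d = _ := h2
      exact hne (by rw [h1, h2])
  · exact absurd hp (by simp [lsPart])
  · exact absurd hp (by simp [lsPart])
  · have hab : i = i' := Sum.inr_injective hp
    subst hab
    rcases h with h | ⟨⟨k, e⟩ | ⟨k, e⟩, h1, h2⟩
    · exact h
    · have h1 : e = j + (((i : ℕ) : ZMod n) + 1) * ((k : ℕ) : ZMod n) := h1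
      have h2 : e = j' + (((i : ℕ) : ZMod n) + 1) * ((k : ℕ) : ZMod n) := h2
      exact hne (by rw [add_right_cancel (h1.symm.trans h2)])
    · exact h1

lemma square_adj_PQ (n : ℕ) [Fact n.Prime] (a : Fin n) (c : ZMod n) (i : Fin (n - 1))
    (j : ZMod n) : (graphSquare (latinGraph n)).Adj (Sum.inl (a, c)) (Sum.inr (i, j)) := by
  have hi : (((i : ℕ) : ZMod n) + 1) ≠ 0 := by
    have hlt := i.2
    intro h0
    have h0' : (((i : ℕ) + 1 : ℕ) : ZMod n) = ((0 : ℕ) : ZMod n) := by push_cast; exact h0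
    have := cast_inj_of_lt (by omega) (by omega) h0'
    omega
  obtain ⟨k, hk⟩ := exists_fin ((c - j) / (((i : ℕ) : ZMod n) + 1))
  have hkc : c = j + (((i : ℕ) : ZMod n) + 1) * ((k : ℕ) : ZMod n) := by
    rw [hk]; field_simp; ring
  refine ⟨fun h => (nomatch h), ?_⟩
  by_cases hak : a = k
  · subst hak
    exact Or.inl hkc
  · exact Or.inr ⟨Sum.inl (k, c), ⟨rfl, hak⟩, hkc⟩

lemma square_adj (n : ℕ) [Fact n.Prime] (x y : LSVertex n) (hp : lsPart n x ≠ lsPart n y) :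
    (graphSquare (latinGraph n)).Adj x y := by
  rcases x with ⟨a, c⟩ | ⟨i, j⟩ <;> rcases y with ⟨b, d⟩ | ⟨i', j'⟩
  · have hab : a ≠ b := fun h => hp (by rw [h]; rfl)
    refine ⟨fun h => hp (by rw [h]), ?_⟩
    by_cases hcd : c = d
    · exact Or.inl ⟨hcd, hab⟩
    · have hs : ((a : ℕ) : ZMod n) - ((b : ℕ) : ZMod n) ≠ 0 := by
        rw [sub_ne_zero]
        exact fun h => hab (Fin.ext (cast_inj_of_lt a.2 b.2 h))
      obtain ⟨i, hi⟩ := exists_fin_pred ((c - d) / (((a : ℕ) : ZMod n) - ((b : ℕ) : ZMod n)))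
        (div_ne_zero (sub_ne_zero.2 hcd) hs)
      have hm : (((i : ℕ) : ZMod n) + 1) * (((a : ℕ) : ZMod n) - ((b : ℕ) : ZMod n)) = c - d := by
        rw [hi]; field_simp
      refine Or.inr ⟨Sum.inr (i, c - (((i : ℕ) : ZMod n) + 1) * ((a : ℕ) : ZMod n)), ?_, ?_⟩
      · show c = c - _ + _
        ring
      · show d = c - (((i : ℕ) : ZMod n) + 1) * ((a : ℕ) : ZMod n)
          + (((i : ℕ) : ZMod n) + 1) * ((b : ℕ) : ZMod n)
        linear_combination hm
  · exact square_adj_PQ n a c i' j'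
  · exact (square_adj_PQ n b d i j).symm
  · have hii : i ≠ i' := fun h => hp (by rw [h]; rfl)
    refine ⟨fun h => hp (by rw [h]), Or.inr ?_⟩
    have hs : ((i : ℕ) : ZMod n) - ((i' : ℕ) : ZMod n) ≠ 0 := by
      rw [sub_ne_zero]
      have h1 := i.2
      have h2 := i'.2
      exact fun h => hii (Fin.ext (cast_inj_of_lt (by omega) (by omega) h))
    obtain ⟨k, hk⟩ := exists_fin ((j' - j) / (((i : ℕ) : ZMod n) - ((i' : ℕ) : ZMod n)))
    have hm : (((i : ℕ) : ZMod n) - ((i' : ℕ) : ZMod n)) * ((k : ℕ) : ZMod n) = j' - j := by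
      rw [hk]; field_simp
    refine ⟨Sum.inl (k, j + (((i : ℕ) : ZMod n) + 1) * ((k : ℕ) : ZMod n)), rfl, ?_⟩
    show j + (((i : ℕ) : ZMod n) + 1) * ((k : ℕ) : ZMod n)
      = j' + (((i' : ℕ) : ZMod n) + 1) * ((k : ℕ) : ZMod n)
    linear_combination hm

/-- A finite graph is choosable from lists of size the number of vertices (Hall). -/
lemma choosable_card {V : Type} [Fintype V] (G : SimpleGraph V) :
    Choosable G (Fintype.card V) := by
  classical
  intro L hL
  obtain ⟨f, hf, hfL⟩ := (Finset.all_card_le_biUnion_card_iff_exists_injective L).1 (by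
    intro s
    rcases s.eq_empty_or_nonempty with rfl | ⟨v, hv⟩
    · simp
    · exact (Finset.card_le_univ s).trans ((hL v).trans
        (Finset.card_le_card (Finset.subset_biUnion_of_mem L hv))))
  exact ⟨f, hfL, fun u w h e => h.ne (hf e)⟩

lemma not_choosable (n : ℕ) [Fact n.Prime] (hn : 3 ≤ n) (k : ℕ) (hk : k ≤ (n - 1) * 3) :
    ¬ Choosable (graphSquare (latinGraph n)) k := by
  classical
  intro h
  obtain ⟨e⟩ : Nonempty (ZMod n × Fin 3 ↪ ℕ) :=
    ⟨(Fintype.equivFin (ZMod n × Fin 3)).toEmbedding.trans Fin.valEmbedding⟩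
  obtain ⟨φ, hφ, hadj⟩ := h
    (fun v => ((Finset.univ.erase (lsPos n v)) ×ˢ (Finset.univ : Finset (Fin 3))).map e) (by
      intro v
      simpa [Finset.card_erase_of_mem, ZMod.card] using hk)
  have hψ : ∀ v, ∃ q : ZMod n × Fin 3, q.1 ≠ lsPos n v ∧ e q = φ v := by
    intro v
    obtain ⟨q, hq, hqe⟩ := Finset.mem_map.1 (hφ v)
    exact ⟨q, by simpa using hq, hqe⟩
  choose ψ hψ1 hψ2 using hψ
  have hne : ∀ x y, lsPart n x ≠ lsPart n y → ψ x ≠ ψ y := by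
    intro x y hxy he
    exact hadj (square_adj n x y hxy) (by rw [← hψ2, ← hψ2, he])
  let g : (Fin n ⊕ Fin (n - 1)) × Bool → LSVertex n := fun p =>
    lsMk n p.1 (if p.2 then (ψ (lsMk n p.1 0)).1 else 0)
  have hg : ∀ p, lsPart n (g p) = p.1 := fun p => lsPart_mk _ _ _
  have hdiff : ∀ p, ψ (g (p, true)) ≠ ψ (g (p, false)) := by
    intro p he
    have h1 := hψ1 (g (p, true))
    rw [he] at h1
    apply h1
    simp [g, lsPos_mk]
  have hinj : Function.Injective (fun p => ψ (g p)) := by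
    rintro ⟨p, b⟩ ⟨q, c⟩ he
    have he : ψ (g (p, b)) = ψ (g (q, c)) := he
    by_cases hpq : p = q
    · subst hpq
      cases b <;> cases c
      · rfl
      · exact absurd he.symm (hdiff p)
      · exact absurd he (hdiff p)
      · rfl
    · exact absurd he (hne _ _ (by rw [hg, hg]; exact hpq))
  have hc := Fintype.card_le_of_injective _ hinj
  simp [ZMod.card] at hc
  omega

theorem exists_graph_square_list_chromatic_gap (k : ℤ) :
    ∃ (V : Type) (_ : Fintype V) (G : SimpleGraph V),
      k ≤ (listChromaticNumber (graphSquare G) : ℤ) - (chromNum (graphSquare G) : ℤ) := by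
  obtain ⟨n, hn, hp⟩ := Nat.exists_infinite_primes (k.toNat + 3)
  have : Fact n.Prime := ⟨hp⟩
  let _ : Fintype (LSVertex n) :=
    inferInstanceAs (Fintype ((Fin n × ZMod n) ⊕ (Fin (n - 1) × ZMod n)))
  refine ⟨LSVertex n, inferInstance, latinGraph n, ?_⟩
  have h1 : chromNum (graphSquare (latinGraph n)) ≤ n + (n - 1) := by
    apply Nat.sInf_le
    have hc := (SimpleGraph.Coloring.mk (G := graphSquare (latinGraph n)) (lsPart n)
      (fun {x y} h => square_not_adj n x y h)).colorable
    simpa using hc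
  have h2 : (n - 1) * 3 < listChromaticNumber (graphSquare (latinGraph n)) := by
    by_contra hcon
    exact not_choosable n (by omega) _ (not_lt.1 hcon)
      (Nat.sInf_mem (s := {k | Choosable (graphSquare (latinGraph n)) k}) ⟨_, choosable_card (graphSquare (latinGraph n))⟩)
  omega
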